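/- Hook-content sum rule at $t$ as formal power series: $\sum_{Y \text{ partition}} t^{|Y|} \prod_{s\in Y}\frac{(\alpha+c(s))(\beta+c(s))}{h(s)^2} = (1-t)^{-\alpha\beta}$, as an identity of formal power series in $t$ with coefficients polynomial in $\alpha,\beta$, where $c(s)=j-i$ is the content and $h(s)$ the hook length of box $s=(i,j)\in Y$. -/

import Mathlib

open Finset

/-- Content of the box `s = (i,j)`: `c(s) = j - i` (0-indexed). -/
noncomputable def contentQ (s : ℕ × ℕ) : ℚ := (s.2 : ℚ) - (s.1 : ℚ)

/-- Hook length of the box `s = (i,j)` of the Young diagram `Y`: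
`h(s) = Y_i - j + Y'_j - i - 1` (0-indexed), as a rational number. -/
noncomputable def hookQ (Y : YoungDiagram) (s : ℕ × ℕ) : ℚ :=
  (Y.rowLen s.1 : ℚ) + (Y.colLen s.2 : ℚ) - s.1 - s.2 - 1

namespace HCS

/-- The product of `1 + ε/(x i - x j)` over `j ∈ s`, `j ≠ i`. -/
noncomputable def wt {ι : Type*} [DecidableEq ι] (ε : ℚ) (x : ι → ℚ) (s : Finset ι) (i : ι) : ℚ :=
  ∏ j ∈ s.erase i, (1 + ε / (x i - x j))

lemma wt_insert_self {ι : Type*} [DecidableEq ι] (ε : ℚ) (x : ι → ℚ) (s : Finset ι) (v : ι)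
    (hv : v ∉ s) : wt ε x (insert v s) v = ∏ j ∈ s, (1 + ε / (x v - x j)) := by
  unfold wt
  rw [Finset.erase_insert hv]

lemma wt_insert {ι : Type*} [DecidableEq ι] (ε : ℚ) (x : ι → ℚ) (s : Finset ι) (v i : ι)
    (hv : v ∉ s) (hi : i ∈ s) :
    wt ε x (insert v s) i = (1 + ε / (x i - x v)) * wt ε x s i := by
  unfold wt
  have hne : v ≠ i := fun h => hv (h ▸ hi)
  rw [Finset.erase_insert_of_ne hne, Finset.prod_insert]
  simp [hv]

lemma partial_fractions {ι : Type*} [DecidableEq ι] (ε : ℚ) (x : ι → ℚ) (hx : Function.Injective x)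
    (s : Finset ι) : ∀ y : ℚ, (∀ j ∈ s, y ≠ x j) →
    ∏ j ∈ s, (1 + ε / (y - x j)) = 1 + ε * ∑ j ∈ s, wt ε x s j / (y - x j) := by
  induction s using Finset.induction_on with
  | empty => intro y _; simp
  | insert v s hv ih =>
    intro y hy
    have hyv : y - x v ≠ 0 := sub_ne_zero.2 (hy v (by simp))
    have hys : ∀ j ∈ s, y ≠ x j := fun j hj => hy j (by simp [hj])
    have hvs : ∀ j ∈ s, x v ≠ x j := fun j hj h => hv (hx h ▸ hj)
    rw [Finset.prod_insert hv, Finset.sum_insert hv, wt_insert_self _ _ _ _ hv, ih y hys,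
      ih (x v) hvs]
    have key : ∑ j ∈ s, wt ε x (insert v s) j / (y - x j)
        = ∑ j ∈ s, (wt ε x s j / (y - x j) + ε / (y - x v) * (wt ε x s j / (y - x j))
          - ε / (y - x v) * (wt ε x s j / (x v - x j))) := by
      refine Finset.sum_congr rfl fun j hj => ?_
      rw [wt_insert _ _ _ _ _ hv hj]
      have h1 : y - x j ≠ 0 := sub_ne_zero.2 (hys j hj)
      have h2 : x v - x j ≠ 0 := sub_ne_zero.2 (hvs j hj)
      have h3 : x j - x v ≠ 0 := sub_ne_zero.2 (hvs j hj).symm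
      rw [show x j - x v = -(x v - x j) by ring]
      field_simp
      ring
    rw [key, Finset.sum_sub_distrib, Finset.sum_add_distrib, ← Finset.mul_sum, ← Finset.mul_sum]
    field_simp
    ring

lemma sum_wt {ι : Type*} [DecidableEq ι] (ε : ℚ) (x : ι → ℚ) (hx : Function.Injective x)
    (s : Finset ι) : ∑ i ∈ s, wt ε x s i = s.card := by
  induction s using Finset.induction_on with
  | empty => simp
  | insert v s hv ih =>
    have hvs : ∀ j ∈ s, x v ≠ x j := fun j hj h => hv (hx h ▸ hj)
    rw [Finset.sum_insert hv, wt_insert_self _ _ _ _ hv, partial_fractions ε x hx s _ hvs,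
      Finset.card_insert_of_notMem hv]
    have key : ∑ j ∈ s, wt ε x (insert v s) j
        = ∑ j ∈ s, (wt ε x s j - ε * (wt ε x s j / (x v - x j))) := by
      refine Finset.sum_congr rfl fun j hj => ?_
      rw [wt_insert _ _ _ _ _ hv hj]
      have h2 : x v - x j ≠ 0 := sub_ne_zero.2 (hvs j hj)
      rw [show x j - x v = -(x v - x j) by ring]
      field_simp
      ring
    rw [key, Finset.sum_sub_distrib, ← Finset.mul_sum, ih]
    push_cast
    ring

lemma sum_mul_wt {ι : Type*} [DecidableEq ι] (ε : ℚ) (x : ι → ℚ) (hx : Function.Injective x)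
    (s : Finset ι) : ∑ i ∈ s, x i * wt ε x s i
      = ∑ i ∈ s, x i + ε * ((s.card : ℚ) * (s.card - 1) / 2) := by
  induction s using Finset.induction_on with
  | empty => simp
  | insert v s hv ih =>
    have hvs : ∀ j ∈ s, x v ≠ x j := fun j hj h => hv (hx h ▸ hj)
    rw [Finset.sum_insert hv, wt_insert_self _ _ _ _ hv, partial_fractions ε x hx s _ hvs,
      Finset.card_insert_of_notMem hv, Finset.sum_insert hv]
    have key : ∑ j ∈ s, x j * wt ε x (insert v s) j
        = ∑ j ∈ s, (x j * wt ε x s j + ε * wt ε x s j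
          - ε * x v * (wt ε x s j / (x v - x j))) := by
      refine Finset.sum_congr rfl fun j hj => ?_
      rw [wt_insert _ _ _ _ _ hv hj]
      have h2 : x v - x j ≠ 0 := sub_ne_zero.2 (hvs j hj)
      rw [show x j - x v = -(x v - x j) by ring]
      field_simp
      ring
    rw [key, Finset.sum_sub_distrib, Finset.sum_add_distrib, ← Finset.mul_sum, ← Finset.mul_sum,
      ih, sum_wt ε x hx]
    push_cast
    ring

/-- Vandermonde product. -/
noncomputable def vdm {N : ℕ} (x : Fin N → ℚ) : ℚ := ∏ i, ∏ k ∈ Finset.Ioi i, (x i - x k)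

lemma prod_pairs_single {N : ℕ} (r : Fin N → Fin N → ℚ) (i : Fin N) (hs : ∀ m k, r m k = r k m)
    (h1 : ∀ m k, m ≠ k → m ≠ i → k ≠ i → r m k = 1) :
    ∏ m, ∏ k ∈ Finset.Ioi m, r m k = ∏ j ∈ Finset.univ.erase i, r i j := by
  rw [← Finset.mul_prod_erase _ _ (Finset.mem_univ i)]
  have h2 : ∏ m ∈ Finset.univ.erase i, ∏ k ∈ Finset.Ioi m, r m k
      = ∏ m ∈ Finset.univ.erase i, if m < i then r i m else 1 := by
    refine Finset.prod_congr rfl fun m hm => ?_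
    have hm' : m ≠ i := (Finset.mem_erase.1 hm).1
    split_ifs with h
    · rw [Finset.prod_eq_single i]
      · exact hs _ _
      · intro k hk' hk; exact h1 _ _ (Finset.mem_Ioi.1 hk').ne hm' hk
      · intro h'; exact absurd (Finset.mem_Ioi.2 h) h'
    · refine Finset.prod_eq_one fun k hk => h1 _ _ (Finset.mem_Ioi.1 hk).ne hm' ?_
      rintro rfl
      exact h (Finset.mem_Ioi.1 hk)
  have h3 : ∏ k ∈ Finset.Ioi i, r i k = ∏ m ∈ Finset.univ.erase i, if i < m then r i m else 1 := by
    rw [← Finset.prod_filter]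
    refine Finset.prod_congr ?_ fun _ _ => rfl
    ext m
    simp only [Finset.mem_Ioi, Finset.mem_filter, Finset.mem_erase, Finset.mem_univ, and_true]
    exact ⟨fun h => ⟨h.ne', h⟩, fun h => h.2⟩
  rw [h2, h3, ← Finset.prod_mul_distrib]
  refine Finset.prod_congr rfl fun m hm => ?_
  have hm' : m ≠ i := (Finset.mem_erase.1 hm).1
  rcases lt_or_gt_of_ne hm' with h | h
  · simp [h, h.not_gt]
  · simp [h, h.not_gt]

lemma vdm_shift {N : ℕ} (x x' : Fin N → ℚ) (hx : Function.Injective x) (i : Fin N) (ε : ℚ)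
    (hi : x' i = x i + ε) (hne : ∀ j, j ≠ i → x' j = x j) :
    vdm x' = vdm x * wt ε x Finset.univ i := by
  have h := prod_pairs_single (fun m k => (x' m - x' k) / (x m - x k)) i
    (fun m k => by
      rw [← neg_sub (x' k), ← neg_sub (x k), neg_div_neg_eq])
    (fun m k hmk hm hk => by
      rw [hne m hm, hne k hk, div_self]
      exact sub_ne_zero.2 fun h => hmk (hx h))
  have h2 : wt ε x Finset.univ i
      = ∏ j ∈ Finset.univ.erase i, (x' i - x' j) / (x i - x j) := by
    refine Finset.prod_congr rfl fun j hj => ?_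
    have hj' : j ≠ i := (Finset.mem_erase.1 hj).1
    have h3 : x i - x j ≠ 0 := sub_ne_zero.2 fun h => hj' (hx h).symm
    rw [hi, hne j hj']
    field_simp
    ring
  rw [h2, ← h]
  unfold vdm
  rw [← Finset.prod_mul_distrib]
  refine Finset.prod_congr rfl fun m _ => ?_
  rw [← Finset.prod_mul_distrib]
  refine Finset.prod_congr rfl fun k hk => ?_
  have h3 : x m - x k ≠ 0 := sub_ne_zero.2 fun h => (Finset.mem_Ioi.1 hk).ne (hx h)
  field_simp

/-- Shifted row lengths. -/
def sh {N : ℕ} (a : Fin N → ℕ) (i : Fin N) : ℕ := a i + (N - 1 - i)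

/-- Shifted row lengths, as rationals. -/
noncomputable def shq {N : ℕ} (a : Fin N → ℕ) (i : Fin N) : ℚ := (sh a i : ℚ)

lemma shq_eq {N : ℕ} (a : Fin N → ℕ) (i : Fin N) : shq a i = (a i : ℚ) + N - 1 - i := by
  have : ((N - 1 - (i : ℕ) : ℕ) : ℚ) = (N : ℚ) - 1 - i := by
    have := i.2
    rw [Nat.sub_sub, Nat.cast_sub (by omega)]
    push_cast; ring
  unfold shq sh
  push_cast
  rw [this]; ring

lemma sh_strictAnti {N : ℕ} (a : Fin N → ℕ) (ha : Antitone a) : StrictAnti (sh a) := by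
  intro i j hij
  have h1 := ha hij.le
  have h2 : (i : ℕ) < j := hij
  have := j.2
  unfold sh
  omega

lemma shq_inj {N : ℕ} (a : Fin N → ℕ) (ha : Antitone a) : Function.Injective (shq a) := by
  intro i j h
  unfold shq at h
  exact (sh_strictAnti a ha).injective (by exact_mod_cast h)

/-- The inverse hook product, in terms of shifted row lengths. -/
noncomputable def fd {N : ℕ} (a : Fin N → ℕ) : ℚ := vdm (shq a) / ∏ i, ((sh a i).factorial : ℚ)

/-- Adding a box in row `i`. -/
def up {N : ℕ} (b : Fin N → ℕ) (i : Fin N) : Fin N → ℕ := Function.update b i (b i + 1)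

/-- Removing a box in row `i`. -/
def dn {N : ℕ} (b : Fin N → ℕ) (i : Fin N) : Fin N → ℕ := Function.update b i (b i - 1)

lemma up_dn {N : ℕ} (a : Fin N → ℕ) (i : Fin N) (h : 0 < a i) : up (dn a i) i = a := by
  unfold up dn
  simp [Nat.sub_add_cancel h]

lemma dn_up {N : ℕ} (a : Fin N → ℕ) (i : Fin N) : dn (up a i) i = a := by
  unfold up dn
  simp

lemma sh_up_self {N : ℕ} (b : Fin N → ℕ) (i : Fin N) : sh (up b i) i = sh b i + 1 := by
  simp [sh, up]; omega

lemma sh_up_ne {N : ℕ} (b : Fin N → ℕ) (i j : Fin N) (h : j ≠ i) : sh (up b i) j = sh b j := by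
  simp [sh, up, h]

lemma prod_fact_up {N : ℕ} (b : Fin N → ℕ) (i : Fin N) :
    ∏ j, ((sh (up b i) j).factorial : ℚ) = (shq b i + 1) * ∏ j, ((sh b j).factorial : ℚ) := by
  rw [← Finset.mul_prod_erase _ _ (Finset.mem_univ i), ← Finset.mul_prod_erase _ (fun j => ((sh b j).factorial : ℚ)) (Finset.mem_univ i),
    sh_up_self, Nat.factorial_succ]
  have : ∏ j ∈ Finset.univ.erase i, ((sh (up b i) j).factorial : ℚ)
      = ∏ j ∈ Finset.univ.erase i, ((sh b j).factorial : ℚ) :=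
    Finset.prod_congr rfl fun j hj => by rw [sh_up_ne _ _ _ (Finset.mem_erase.1 hj).1]
  rw [this]
  unfold shq
  push_cast
  ring

lemma fd_up {N : ℕ} (b : Fin N → ℕ) (hb : Antitone b) (i : Fin N) :
    fd (up b i) = fd b * (wt 1 (shq b) Finset.univ i / (shq b i + 1)) := by
  unfold fd
  rw [prod_fact_up, vdm_shift (shq b) (shq (up b i)) (shq_inj b hb) i 1
    (by unfold shq; rw [sh_up_self]; push_cast; ring)
    (fun j hj => by unfold shq; rw [sh_up_ne _ _ _ hj])]
  have : shq b i + 1 ≠ 0 := by unfold shq; positivity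
  have : ∏ j, ((sh b j).factorial : ℚ) ≠ 0 := Finset.prod_ne_zero_iff.2 fun j _ => by positivity
  field_simp

lemma fd_dn {N : ℕ} (a : Fin N → ℕ) (ha : Antitone a) (i : Fin N) (hi : 0 < a i) :
    fd (dn a i) = fd a * (shq a i * wt (-1) (shq a) Finset.univ i) := by
  obtain ⟨b, hb⟩ : ∃ b, b = dn a i := ⟨_, rfl⟩
  have hab : a = up b i := by rw [hb, up_dn a i hi]
  have h1 : shq a i = shq b i + 1 := by unfold shq; rw [hab, sh_up_self]; push_cast; ring
  rw [← hb]
  have h2 := vdm_shift (shq a) (shq b) (shq_inj a ha) i (-1) (by rw [h1]; ring)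
    (fun j hj => by unfold shq; rw [hab, sh_up_ne _ _ _ hj])
  have h3 : ∏ j, ((sh a j).factorial : ℚ) = (shq b i + 1) * ∏ j, ((sh b j).factorial : ℚ) := by
    rw [hab, prod_fact_up]
  unfold fd
  rw [h2, h3, h1]
  have : shq b i + 1 ≠ 0 := by unfold shq; positivity
  have : ∏ j, ((sh b j).factorial : ℚ) ≠ 0 := Finset.prod_ne_zero_iff.2 fun j _ => by positivity
  field_simp

lemma wt_zero {N : ℕ} (x : Fin N → ℚ) (i j : Fin N) (ε : ℚ) (hji : j ≠ i) (hε : ε ≠ 0)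
    (h : x j = x i + ε) : wt ε x Finset.univ i = 0 := by
  unfold wt
  refine Finset.prod_eq_zero (Finset.mem_erase.2 ⟨hji, Finset.mem_univ j⟩) ?_
  rw [h]
  have : x i - (x i + ε) = -ε := by ring
  rw [this, div_neg, div_self hε]
  ring

lemma up_zero {N : ℕ} (b : Fin N → ℕ) (hb : Antitone b) (i : Fin N) (h : ¬ Antitone (up b i)) :
    wt 1 (shq b) Finset.univ i = 0 := by
  have h' : ∃ m k : Fin N, m ≤ k ∧ up b i m < up b i k := by
    by_contra hc
    push Not at hc
    exact h fun m k hmk => hc m k hmk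
  obtain ⟨m, k, hmk, hlt⟩ := h'
  have hb1 := hb hmk
  have hk : k = i := by
    by_contra hk
    by_cases hm : m = i
    · subst hm; simp [up, hk] at hlt; omega
    · simp [up, hk, hm] at hlt; omega
  subst hk
  have hm : m ≠ k := by rintro rfl; exact lt_irrefl _ hlt
  simp [up, hm] at hlt
  have hmk' : (m : ℕ) < k := lt_of_le_of_ne hmk (fun h => hm (Fin.ext h))
  have hp : (k : ℕ) - 1 < N := by have := k.2; omega
  have e1 : b ⟨k - 1, hp⟩ ≤ b m := hb (Fin.le_def.2 (by simp; omega))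
  have e2 : b k ≤ b ⟨k - 1, hp⟩ := hb (Fin.le_def.2 (by simp))
  have e3 : b ⟨k - 1, hp⟩ = b k := by omega
  refine wt_zero _ k ⟨k - 1, hp⟩ 1 (fun h => by have := congrArg Fin.val h; simp at this; omega) one_ne_zero ?_
  rw [shq_eq, shq_eq, e3]
  simp only
  rw [Nat.cast_sub (by omega)]
  push_cast; ring

lemma dn_zero {N : ℕ} (a : Fin N → ℕ) (ha : Antitone a) (i : Fin N)
    (h : ¬ (0 < a i ∧ Antitone (dn a i))) :
    shq a i * wt (-1) (shq a) Finset.univ i = 0 := by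
  by_cases hq : (i : ℕ) + 1 < N
  · by_cases he : a ⟨i + 1, hq⟩ = a i
    · rw [wt_zero (shq a) i ⟨i + 1, hq⟩ (-1) (fun h => by have := congrArg Fin.val h; simp at this) (by norm_num), mul_zero]
      rw [shq_eq, shq_eq, he]
      push_cast; ring
    · exfalso
      apply h
      have e2 : a ⟨i + 1, hq⟩ ≤ a i := ha (Fin.le_def.2 (by simp))
      refine ⟨by omega, ?_⟩
      intro m k hmk
      have hh := ha hmk
      by_cases hm : m = i
      · subst hm
        by_cases hk : k = m
        · subst hk; exact le_rfl
        · have hmk' : (m : ℕ) < k := lt_of_le_of_ne hmk (fun h => hk (Fin.ext h.symm))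
          have e1 : a k ≤ a ⟨m + 1, hq⟩ := ha (Fin.le_def.2 (by simp; omega))
          simp [dn, hk]; omega
      · by_cases hk : k = i
        · subst hk; simp [dn, hm]; omega
        · simp [dn, hm, hk]; exact hh
  · by_cases h0 : a i = 0
    · have : shq a i = 0 := by
        unfold shq sh
        rw [h0]; have := i.2
        simp; omega
      rw [this, zero_mul]
    · exfalso
      apply h
      refine ⟨by omega, ?_⟩
      intro m k hmk
      have hh := ha hmk
      by_cases hm : m = i
      · have : k = i := by
          subst hm
          apply Fin.ext
          have h1 := k.2
          have h2 : (m : ℕ) ≤ k := hmk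
          omega
        rw [this, hm]
      · by_cases hk : k = i
        · subst hk; simp [dn, hm]; omega
        · simp [dn, hm, hk]; exact hh

lemma sum_shq {N : ℕ} (a : Fin N → ℕ) :
    ∑ i, shq a i = ((∑ i, a i : ℕ) : ℚ) + (N : ℚ) * (N - 1) / 2 := by
  have h : ∀ M : ℕ, ∑ i : Fin M, (i : ℚ) = (M : ℚ) * (M - 1) / 2 := by
    intro M
    induction M with
    | zero => simp
    | succ M ih => rw [Fin.sum_univ_castSucc]; simp [ih]; ring
  simp only [shq_eq]
  rw [Finset.sum_sub_distrib, h]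
  rw [Finset.sum_sub_distrib, Finset.sum_add_distrib]
  simp
  ring

lemma down_identity {N : ℕ} (a : Fin N → ℕ) (ha : Antitone a) :
    ∑ i, shq a i * wt (-1) (shq a) Finset.univ i = ((∑ i, a i : ℕ) : ℚ) := by
  rw [sum_mul_wt (-1) _ (shq_inj a ha), sum_shq]
  simp

lemma up_identity {N : ℕ} (α β : ℚ) (b : Fin N → ℕ) (hb : Antitone b) (hN : ∑ i, b i < N) :
    ∑ i, ((α + ((b i : ℚ) - i)) * (β + ((b i : ℚ) - i)))
      * (wt 1 (shq b) Finset.univ i / (shq b i + 1)) = α * β + ((∑ i, b i : ℕ) : ℚ) := by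
  have hex : ∃ i, b i = 0 ∧ (i : ℕ) + 1 = N := by
    have hp : N - 1 < N := by omega
    refine ⟨⟨N - 1, hp⟩, ?_, by simp; omega⟩
    by_contra hc
    have : ∑ i : Fin N, 1 ≤ ∑ i, b i := Finset.sum_le_sum fun i _ => by
      have : b ⟨N - 1, hp⟩ ≤ b i := hb (Fin.le_def.2 (by simp; omega))
      omega
    simp at this
    omega
  obtain ⟨z, hz, hzN⟩ := hex
  have hz0 : shq b z = 0 := by
    unfold shq sh; rw [hz]; simp; omega
  have hpos : ∀ i, shq b i + 1 ≠ 0 := fun i => by unfold shq; positivity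
  have s0 : ∑ i, wt 1 (shq b) Finset.univ i / (shq b i + 1) = 1 := by
    have hp := partial_fractions 1 (shq b) (shq_inj b hb) Finset.univ (-1)
      (fun j _ h => hpos j (by rw [← h]; ring))
    rw [Finset.prod_eq_zero (Finset.mem_univ z) (by rw [hz0]; norm_num)] at hp
    have h2 : ∑ i, wt 1 (shq b) Finset.univ i / (-1 - shq b i)
        = - ∑ i, wt 1 (shq b) Finset.univ i / (shq b i + 1) := by
      rw [← Finset.sum_neg_distrib]
      refine Finset.sum_congr rfl fun i _ => ?_
      rw [show -1 - shq b i = -(shq b i + 1) by ring, div_neg]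
    rw [h2] at hp
    linarith
  have s1 := sum_wt 1 (shq b) (shq_inj b hb) Finset.univ
  have s2 := sum_mul_wt 1 (shq b) (shq_inj b hb) Finset.univ
  rw [sum_shq] at s2
  simp only [Finset.card_univ, Fintype.card_fin] at s1 s2
  have key : ∀ i : Fin N, ((α + ((b i : ℚ) - i)) * (β + ((b i : ℚ) - i)))
      * (wt 1 (shq b) Finset.univ i / (shq b i + 1))
      = (α - N) * (β - N) * (wt 1 (shq b) Finset.univ i / (shq b i + 1))
        + (α + β - 2 * N + 1) * wt 1 (shq b) Finset.univ i
        + shq b i * wt 1 (shq b) Finset.univ i := by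
    intro i
    have h1 : (b i : ℚ) - i = (shq b i + 1) - N := by rw [shq_eq]; ring
    rw [h1]
    have := hpos i
    field_simp
    ring
  rw [Finset.sum_congr rfl fun i _ => key i, Finset.sum_add_distrib, Finset.sum_add_distrib,
    ← Finset.mul_sum, ← Finset.mul_sum, s0, s1, s2]
  ring

/-- Content product. -/
noncomputable def cp {N : ℕ} (α β : ℚ) (a : Fin N → ℕ) : ℚ :=
  ∏ i : Fin N, ∏ j ∈ Finset.range (a i), ((α + ((j : ℚ) - i)) * (β + ((j : ℚ) - i)))

lemma cp_up {N : ℕ} (α β : ℚ) (b : Fin N → ℕ) (i : Fin N) :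
    cp α β (up b i) = cp α β b * ((α + ((b i : ℚ) - i)) * (β + ((b i : ℚ) - i))) := by
  unfold cp
  rw [← Finset.mul_prod_erase _ _ (Finset.mem_univ i), ← Finset.mul_prod_erase _
    (fun i : Fin N => ∏ j ∈ Finset.range (b i), ((α + ((j : ℚ) - i)) * (β + ((j : ℚ) - i))))
    (Finset.mem_univ i)]
  have h1 : up b i i = b i + 1 := by simp [up]
  rw [h1, Finset.prod_range_succ]
  have h2 : ∏ m ∈ Finset.univ.erase i, ∏ j ∈ Finset.range (up b i m),
        ((α + ((j : ℚ) - m)) * (β + ((j : ℚ) - m)))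
      = ∏ m ∈ Finset.univ.erase i, ∏ j ∈ Finset.range (b m),
        ((α + ((j : ℚ) - m)) * (β + ((j : ℚ) - m))) :=
    Finset.prod_congr rfl fun m hm => by
      rw [show up b i m = b m by simp [up, (Finset.mem_erase.1 hm).1]]
  rw [h2]
  ring

/-- Partitions of `n` with at most `N` rows. -/
noncomputable def parts (N n : ℕ) : Finset (Fin N → ℕ) :=
  open Classical in (Finset.piAntidiag Finset.univ n).filter Antitone

lemma mem_parts {N n : ℕ} (a : Fin N → ℕ) : a ∈ parts N n ↔ ∑ i, a i = n ∧ Antitone a := by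
  simp [parts, Finset.mem_piAntidiag]

lemma sum_up {N : ℕ} (b : Fin N → ℕ) (i : Fin N) : ∑ j, up b i j = ∑ j, b j + 1 := by
  rw [← Finset.add_sum_erase _ _ (Finset.mem_univ i), ← Finset.add_sum_erase _ b (Finset.mem_univ i)]
  have h1 : up b i i = b i + 1 := by simp [up]
  rw [h1, Finset.sum_congr rfl (fun j hj => by
    rw [show up b i j = b j by simp [up, (Finset.mem_erase.1 hj).1]])]
  ring

lemma step (α β : ℚ) (N n : ℕ) (hn : n < N) :
    ((n : ℚ) + 1) * ∑ a ∈ parts N (n + 1), cp α β a * fd a ^ 2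
      = (α * β + n) * ∑ b ∈ parts N n, cp α β b * fd b ^ 2 := by
  classical
  have hL : ((n : ℚ) + 1) * ∑ a ∈ parts N (n + 1), cp α β a * fd a ^ 2
      = ∑ p ∈ (parts N (n + 1) ×ˢ (Finset.univ : Finset (Fin N))).filter
          (fun p => 0 < p.1 p.2 ∧ Antitone (dn p.1 p.2)),
          cp α β p.1 * fd p.1 * fd (dn p.1 p.2) := by
    rw [Finset.sum_filter, Finset.sum_product, Finset.mul_sum]
    refine Finset.sum_congr rfl fun a ha => ?_
    obtain ⟨h1, h2⟩ := (mem_parts a).1 ha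
    have hd := down_identity a h2
    rw [h1] at hd
    push_cast at hd
    rw [← hd, Finset.sum_mul]
    refine Finset.sum_congr rfl fun i _ => ?_
    simp only
    split_ifs with h
    · rw [fd_dn a h2 i h.1]; ring
    · rw [dn_zero a h2 i h]; ring
  have hR : (α * β + n) * ∑ b ∈ parts N n, cp α β b * fd b ^ 2
      = ∑ p ∈ (parts N n ×ˢ (Finset.univ : Finset (Fin N))).filter
          (fun p => Antitone (up p.1 p.2)),
          cp α β (up p.1 p.2) * fd (up p.1 p.2) * fd p.1 := by
    rw [Finset.sum_filter, Finset.sum_product, Finset.mul_sum]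
    refine Finset.sum_congr rfl fun b hb => ?_
    obtain ⟨h1, h2⟩ := (mem_parts b).1 hb
    have hd := up_identity α β b h2 (by omega)
    rw [h1] at hd
    rw [← hd, Finset.sum_mul]
    refine Finset.sum_congr rfl fun i _ => ?_
    simp only
    split_ifs with h
    · rw [fd_up b h2 i, cp_up]; ring
    · rw [up_zero b h2 i h]; ring
  rw [hL, hR]
  refine Finset.sum_nbij' (fun p => (dn p.1 p.2, p.2)) (fun p => (up p.1 p.2, p.2)) ?_ ?_ ?_ ?_ ?_
  · rintro ⟨a, i⟩ h
    simp only [Finset.mem_filter, Finset.mem_product, mem_parts, Finset.mem_univ, and_true] at h ⊢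
    have := sum_up (dn a i) i
    rw [up_dn a i h.2.1] at this ⊢
    exact ⟨⟨by omega, h.2.2⟩, h.1.2⟩
  · rintro ⟨a, i⟩ h
    simp only [Finset.mem_filter, Finset.mem_product, mem_parts, Finset.mem_univ, and_true] at h ⊢
    rw [dn_up, sum_up]
    exact ⟨⟨by omega, h.2⟩, by simp [up], h.1.2⟩
  · rintro ⟨a, i⟩ h
    simp only [Finset.mem_filter] at h
    simp only [up_dn a i h.2.1]
  · rintro ⟨a, i⟩ h
    simp only [dn_up]
  · rintro ⟨a, i⟩ h
    simp only [Finset.mem_filter] at h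
    simp only [up_dn a i h.2.1]

lemma hook_row {N : ℕ} (Y : YoungDiagram) (hY : Y.colLen 0 ≤ N) (i : Fin N) :
    (∏ j ∈ Finset.range (Y.rowLen i), hookQ Y ((i : ℕ), j)) *
      ∏ k ∈ Finset.Ioi i, (shq (fun i : Fin N => Y.rowLen i) i - shq (fun i : Fin N => Y.rowLen i) k)
      = ((sh (fun i : Fin N => Y.rowLen i) i).factorial : ℚ) := by
  set a : Fin N → ℕ := fun i : Fin N => Y.rowLen i with ha
  have haa : Antitone a := fun m k hmk => Y.rowLen_anti _ _ hmk
  let H : ℕ → ℕ := fun j => Y.rowLen i + Y.colLen j - i - j - 1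
  let K : Fin N → ℕ := fun k => sh a i - sh a k
  have hcol : ∀ j, j < Y.rowLen i → (i : ℕ) < Y.colLen j := fun j hj =>
    YoungDiagram.mem_iff_lt_colLen.1 (YoungDiagram.mem_iff_lt_rowLen.2 hj)
  have hcN : ∀ j, Y.colLen j ≤ N := fun j => (Y.colLen_anti 0 j (Nat.zero_le _)).trans hY
  have hH : ∀ j ∈ Finset.range (Y.rowLen i), hookQ Y ((i : ℕ), j) = (H j : ℚ) := by
    intro j hj
    have h1 := Finset.mem_range.1 hj
    have h2 := hcol j h1
    unfold hookQ
    have : H j + i + j + 1 = Y.rowLen i + Y.colLen j := by simp only [H]; omega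
    have h3 : (H j : ℚ) + i + j + 1 = Y.rowLen i + Y.colLen j := by exact_mod_cast this
    simp only
    linarith
  have hK : ∀ k ∈ Finset.Ioi i, shq a i - shq a k = (K k : ℚ) := by
    intro k hk
    have := sh_strictAnti a haa (Finset.mem_Ioi.1 hk)
    simp only [K, shq]
    rw [Nat.cast_sub this.le]
  rw [Finset.prod_congr rfl hH, Finset.prod_congr rfl hK]
  have hHinj : Set.InjOn H (Finset.range (Y.rowLen i)) := by
    have key : ∀ j j', j < j' → j' < Y.rowLen i → H j' < H j := by
      intro j j' hjj hj'
      have h1 := Y.colLen_anti j j' hjj.le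
      have h2 := hcol j' hj'
      simp only [H]; omega
    intro j hj j' hj' he
    have h1 := Finset.mem_range.1 hj
    have h2 := Finset.mem_range.1 hj'
    rcases lt_trichotomy j j' with h | h | h
    · have := key _ _ h h2; omega
    · exact h
    · have := key _ _ h h1; omega
  have hKinj : Set.InjOn K (Finset.Ioi i) := by
    intro k hk k' hk' he
    have h1 := sh_strictAnti a haa (Finset.mem_Ioi.1 hk)
    have h2 := sh_strictAnti a haa (Finset.mem_Ioi.1 hk')
    apply (sh_strictAnti a haa).injective
    simp only [K] at he
    omega
  have hdisj : Disjoint ((Finset.range (Y.rowLen i)).image H) ((Finset.Ioi i).image K) := by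
    rw [Finset.disjoint_left]
    intro v hv hv'
    obtain ⟨j, hj, rfl⟩ := Finset.mem_image.1 hv
    obtain ⟨k, hk, he⟩ := Finset.mem_image.1 hv'
    have h1 := Finset.mem_range.1 hj
    have h2 := hcol j h1
    have h3 := haa (Finset.mem_Ioi.1 hk).le
    have h4 : (i : ℕ) < k := Fin.lt_def.1 (Finset.mem_Ioi.1 hk)
    have h5 := k.2
    have h6 : j < Y.rowLen k ↔ (k : ℕ) < Y.colLen j :=
      YoungDiagram.mem_iff_lt_rowLen.symm.trans YoungDiagram.mem_iff_lt_colLen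
    simp only [K, H, sh, ha] at he h3
    by_cases h7 : j < Y.rowLen k
    · have := h6.1 h7; omega
    · have := mt h6.2 h7; omega
  have hun : (Finset.range (Y.rowLen i)).image H ∪ (Finset.Ioi i).image K
      = Finset.Icc 1 (sh a i) := by
    apply Finset.eq_of_subset_of_card_le
    · intro v hv
      rcases Finset.mem_union.1 hv with hv | hv
      · obtain ⟨j, hj, rfl⟩ := Finset.mem_image.1 hv
        have h1 := Finset.mem_range.1 hj
        have h2 := hcol j h1
        have h3 := hcN j
        simp only [H, sh, ha, Finset.mem_Icc]
        omega
      · obtain ⟨k, hk, rfl⟩ := Finset.mem_image.1 hv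
        have := sh_strictAnti a haa (Finset.mem_Ioi.1 hk)
        simp only [K, Finset.mem_Icc]
        omega
    · rw [Finset.card_union_of_disjoint hdisj, Finset.card_image_of_injOn hHinj,
        Finset.card_image_of_injOn hKinj]
      simp [sh, ha]
  have hfac : ∀ m : ℕ, ∏ v ∈ Finset.Icc 1 m, v = m.factorial := by
    intro m
    induction m with
    | zero => simp
    | succ m ih => rw [Finset.prod_Icc_succ_top (by omega), ih, Nat.factorial_succ, mul_comm]
  rw [← hfac, ← hun, Finset.prod_union hdisj,
    Finset.prod_image hHinj, Finset.prod_image hKinj]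
  push_cast
  rfl

lemma prod_cells {N : ℕ} (Y : YoungDiagram) (hY : Y.colLen 0 ≤ N) (F : ℕ × ℕ → ℚ) :
    ∏ s ∈ Y.cells, F s = ∏ i : Fin N, ∏ j ∈ Finset.range (Y.rowLen i), F ((i : ℕ), j) := by
  rw [Fin.prod_univ_eq_prod_range (fun i => ∏ j ∈ Finset.range (Y.rowLen i), F (i, j)) N]
  refine Finset.prod_finset_product _ _ (fun i => Finset.range (Y.rowLen i)) ?_
  rintro ⟨i, j⟩
  simp only [YoungDiagram.mem_cells, Finset.mem_range]
  rw [← YoungDiagram.mem_iff_lt_rowLen]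
  refine ⟨fun h => ⟨?_, h⟩, fun h => h.2⟩
  have := YoungDiagram.mem_iff_lt_colLen.1 (Y.up_left_mem le_rfl (Nat.zero_le j) h)
  omega

lemma term_eq {N : ℕ} (α β : ℚ) (Y : YoungDiagram) (hY : Y.colLen 0 ≤ N) :
    ∏ s ∈ Y.cells, ((α + contentQ s) * (β + contentQ s) / (hookQ Y s) ^ 2)
      = cp α β (fun i : Fin N => Y.rowLen i) * fd (fun i : Fin N => Y.rowLen i) ^ 2 := by
  have h1 : fd (fun i : Fin N => Y.rowLen i) = 1 / ∏ s ∈ Y.cells, hookQ Y s := by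
    rw [prod_cells Y hY]
    unfold fd
    have hv : vdm (shq (fun i : Fin N => Y.rowLen i)) ≠ 0 := by
      refine Finset.prod_ne_zero_iff.2 fun i _ => Finset.prod_ne_zero_iff.2 fun k hk => ?_
      refine sub_ne_zero.2 fun h => (Finset.mem_Ioi.1 hk).ne ?_
      exact shq_inj _ (fun m k hmk => Y.rowLen_anti _ _ hmk) h
    rw [← Finset.prod_congr rfl fun i _ => hook_row Y hY i, Finset.prod_mul_distrib]
    change vdm _ / (_ * vdm _) = _
    rw [mul_comm, ← div_div, div_self hv]
  rw [h1, Finset.prod_div_distrib, Finset.prod_pow, prod_cells Y hY (fun s => (α + contentQ s) * (β + contentQ s))]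
  unfold cp contentQ
  simp only
  ring

lemma colLen_le (Y : YoungDiagram) : Y.colLen 0 ≤ Y.cells.card := by
  rw [YoungDiagram.colLen_eq_card]
  exact Finset.card_le_card (Finset.filter_subset _ _)

lemma sum_rowLen {N : ℕ} (Y : YoungDiagram) (hY : Y.colLen 0 ≤ N) :
    ∑ i : Fin N, Y.rowLen i = Y.cells.card := by
  have h := prod_cells Y hY (fun _ => 2)
  simp only [Finset.prod_const, Finset.card_range, Finset.prod_pow_eq_pow_sum] at h
  exact (pow_right_injective₀ (by norm_num) (by norm_num) h).symm

/-- The diagram of an antitone function. -/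
def diag {N : ℕ} (a : Fin N → ℕ) (ha : Antitone a) : YoungDiagram where
  cells := Finset.univ.biUnion fun i : Fin N => (Finset.range (a i)).image fun j => ((i : ℕ), j)
  isLowerSet := by
    rintro ⟨i, j⟩ ⟨i', j'⟩ hle h
    obtain ⟨h1, h2⟩ := Prod.mk_le_mk.1 hle
    simp at h ⊢
    obtain ⟨k, hk, rfl⟩ := h
    refine ⟨⟨i', by omega⟩, ?_, rfl⟩
    have : a k ≤ a ⟨i', by omega⟩ := ha (Fin.le_def.2 h1)
    omega

lemma rowLen_diag {N : ℕ} (a : Fin N → ℕ) (ha : Antitone a) (i : Fin N) :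
    (diag a ha).rowLen i = a i := by
  have : ∀ j, j < (diag a ha).rowLen i ↔ j < a i := by
    intro j
    rw [← YoungDiagram.mem_iff_lt_rowLen, ← YoungDiagram.mem_cells]
    simp [diag, Fin.val_inj]
  exact le_antisymm (not_lt.1 fun h => by have := (this _).1 h; omega)
    (not_lt.1 fun h => by have := (this _).2 h; omega)

lemma colLen_diag {N : ℕ} (a : Fin N → ℕ) (ha : Antitone a) : (diag a ha).colLen 0 ≤ N := by
  by_contra h
  push Not at h
  have := YoungDiagram.mem_iff_lt_colLen.2 h
  rw [← YoungDiagram.mem_cells] at this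
  simp [diag] at this
  obtain ⟨k, _, hk⟩ := this
  have := k.2
  omega

lemma finsum_eq (α β : ℚ) (n : ℕ) :
    (∑ᶠ Y : {Y : YoungDiagram // Y.cells.card = n},
        ∏ s ∈ (Y.1).cells, ((α + contentQ s) * (β + contentQ s) / (hookQ Y.1 s) ^ 2))
      = ∑ a ∈ parts n n, cp α β a * fd a ^ 2 := by
  have hc : ∀ Y : {Y : YoungDiagram // Y.cells.card = n}, Y.1.colLen 0 ≤ n := fun Y =>
    (colLen_le Y.1).trans Y.2.le
  let e : {Y : YoungDiagram // Y.cells.card = n} → {a // a ∈ parts n n} := fun Y =>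
    ⟨fun i => Y.1.rowLen i, (mem_parts _).2 ⟨(sum_rowLen Y.1 (hc Y)).trans Y.2,
      fun m k hmk => Y.1.rowLen_anti _ _ hmk⟩⟩
  have he : Function.Bijective e := by
    constructor
    · intro Y Z h
      apply Subtype.ext
      apply YoungDiagram.ext
      have h' : ∀ i : Fin n, Y.1.rowLen i = Z.1.rowLen i := fun i =>
        congrFun (congrArg Subtype.val h) i
      have key : ∀ W : {Y : YoungDiagram // Y.cells.card = n}, ∀ i j, (i, j) ∈ W.1.cells → i < n := by
        intro W i j hm
        have := YoungDiagram.mem_iff_lt_colLen.1 (W.1.up_left_mem le_rfl (Nat.zero_le j) hm)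
        have := hc W
        omega
      ext ⟨i, j⟩
      by_cases hi : i < n
      · have := h' ⟨i, hi⟩
        simp only at this
        rw [YoungDiagram.mem_cells, YoungDiagram.mem_cells, YoungDiagram.mem_iff_lt_rowLen,
          YoungDiagram.mem_iff_lt_rowLen, this]
      · exact ⟨fun h => absurd (key Y i j h) hi, fun h => absurd (key Z i j h) hi⟩
    · rintro ⟨a, ha⟩
      obtain ⟨h1, h2⟩ := (mem_parts a).1 ha
      refine ⟨⟨diag a h2, ?_⟩, ?_⟩
      · rw [← sum_rowLen (diag a h2) (colLen_diag a h2)]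
        exact (Finset.sum_congr rfl fun i _ => rowLen_diag a h2 i).trans h1
      · apply Subtype.ext
        funext i
        exact rowLen_diag a h2 i
  rw [finsum_eq_of_bijective (g := fun a : {a // a ∈ parts n n} => cp α β a.1 * fd a.1 ^ 2) e he
    (fun Y => term_eq α β Y.1 (hc Y)), finsum_eq_sum_of_fintype]
  exact Finset.sum_coe_sort (parts n n) (fun a => cp α β a * fd a ^ 2)

lemma parts_sum (α β : ℚ) (N n : ℕ) (hn : n ≤ N) :
    ∑ a ∈ parts N n, cp α β a * fd a ^ 2
      = (ascPochhammer ℚ n).eval (α * β) / (Nat.factorial n : ℚ) := by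
  induction n with
  | zero =>
    have h0 : parts N 0 = {fun i : Fin N => (⊥ : YoungDiagram).rowLen i} := by
      have hb : ∀ i, (⊥ : YoungDiagram).rowLen i = 0 := by
        intro i
        by_contra h
        exact YoungDiagram.notMem_bot (i, 0)
          (YoungDiagram.mem_iff_lt_rowLen.2 (Nat.pos_of_ne_zero h))
      ext a
      simp only [mem_parts, Finset.mem_singleton, hb]
      constructor
      · rintro ⟨h, -⟩
        funext i
        exact Finset.sum_eq_zero_iff.1 h i (Finset.mem_univ i)
      · rintro rfl
        exact ⟨by simp, fun _ _ _ => le_rfl⟩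
    rw [h0, Finset.sum_singleton, ← term_eq α β ⊥ ((colLen_le _).trans (by simp))]
    simp
  | succ n ih =>
    have h := step α β N n (by omega)
    rw [ih (by omega)] at h
    have hne : (n : ℚ) + 1 ≠ 0 := by positivity
    rw [ascPochhammer_succ_eval, Nat.factorial_succ]
    have hf : (n.factorial : ℚ) ≠ 0 := by positivity
    push_cast
    field_simp at h ⊢
    linarith

end HCS

/-- Hook-content sum rule:
`∑_Y t^{|Y|} ∏_{s∈Y} (α+c(s))(β+c(s))/h(s)² = (1-t)^{-αβ}`, as an identity of formal power
series in `t` with coefficients polynomial in `α, β`, stated coefficientwise: for every `n`,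
the sum over all partitions of `n` equals `(αβ)_n/n!`, the `n`-th coefficient of
`(1-t)^{-αβ}`. -/
theorem hook_content_sum_rule (α β : ℚ) (n : ℕ) :
    (∑ᶠ Y : {Y : YoungDiagram // Y.cells.card = n},
        ∏ s ∈ (Y.1).cells, ((α + contentQ s) * (β + contentQ s) / (hookQ Y.1 s) ^ 2))
      = (ascPochhammer ℚ n).eval (α * β) / (Nat.factorial n : ℚ) := by
  rw [HCS.finsum_eq, HCS.parts_sum α β n n le_rfl]
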